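/- Let M > 0, m = 1 + 1/M, μ > 0, s ≥ 0 and τ > −μ. Then 4sμ/(M²(s/M + τ + mμ)²) ≤ 1, and the quantity F(s,τ) = ((s/M + τ + mμ)/(s/(M+1) + τ + mμ)) · ( 1 − √( 1 − 4sμ/(M²(s/M + τ + mμ)²) ) ) satisfies 0 ≤ F(s,τ) ≤ 1 + 1/M. -/

import Mathlib

open Real

/-- The function `F(s,τ)` (with `m = 1 + 1/M`). -/
noncomputable def Ffun (M μ s τ : ℝ) : ℝ :=
  ((s / M + τ + (1 + 1 / M) * μ) / (s / (M + 1) + τ + (1 + 1 / M) * μ)) *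
    (1 - Real.sqrt (1 - 4 * s * μ / (M ^ 2 * (s / M + τ + (1 + 1 / M) * μ) ^ 2)))

theorem stmt_9 (M μ s τ : ℝ) (hM : 0 < M) (hμ : 0 < μ) (hs : 0 ≤ s) (hτ : -μ < τ) :
    4 * s * μ / (M ^ 2 * (s / M + τ + (1 + 1 / M) * μ) ^ 2) ≤ 1 ∧
    0 ≤ Ffun M μ s τ ∧ Ffun M μ s τ ≤ 1 + 1 / M := by
  have hA : (s + μ) / M < s / M + τ + (1 + 1 / M) * μ := by
    have h : s / M + τ + (1 + 1 / M) * μ = (s + μ) / M + (τ + μ) := by ring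
    linarith
  have hB : 0 < s / (M + 1) + τ + (1 + 1 / M) * μ := by
    have h : s / (M + 1) + τ + (1 + 1 / M) * μ = s / (M + 1) + μ / M + (τ + μ) := by ring
    have h₁ : 0 ≤ s / (M + 1) := by positivity
    have h₂ : 0 < μ / M := by positivity
    linarith
  have hAB : s / M + τ + (1 + 1 / M) * μ =
      s / (M + 1) + τ + (1 + 1 / M) * μ + s / (M * (M + 1)) := by
    field_simp
    ring
  unfold Ffun
  set A := s / M + τ + (1 + 1 / M) * μ
  set B := s / (M + 1) + τ + (1 + 1 / M) * μ
  have hA0 : 0 < A := lt_of_le_of_lt (by positivity) hA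
  have hsA : s + μ < M * A := by
    rwa [div_lt_iff₀ hM, mul_comm] at hA
  have hAB' : A ≤ (1 + 1 / M) * B := by
    have h : (1 + 1 / M) * B - A = (M * A - s) / M ^ 2 := by
      rw [eq_sub_of_add_eq hAB.symm]
      field_simp
      ring
    have : 0 ≤ (M * A - s) / M ^ 2 := div_nonneg (by linarith) (by positivity)
    linarith
  have hq : 0 ≤ 4 * s * μ / (M ^ 2 * A ^ 2) := by positivity
  have hsqrt : √(1 - 4 * s * μ / (M ^ 2 * A ^ 2)) ≤ 1 :=
    Real.sqrt_le_one.mpr (by linarith)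
  refine ⟨?_, mul_nonneg (by positivity) (by linarith), ?_⟩
  · rw [div_le_one (by positivity)]
    nlinarith [sq_nonneg (s - μ)]
  · calc A / B * (1 - √(1 - 4 * s * μ / (M ^ 2 * A ^ 2))) ≤ A / B :=
          mul_le_of_le_one_right (by positivity) (by
            linarith [Real.sqrt_nonneg (1 - 4 * s * μ / (M ^ 2 * A ^ 2))])
      _ ≤ 1 + 1 / M := (div_le_iff₀ hB).mpr hAB'
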